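/- arXiv:1804.05618 — 5 statements merged into one kernel-verified Lean document; each statement's English description precedes it below -/
import Mathlib

section
/- Let X and Y be linearly ordered sets and let f : X × Y → ℝ be submodular, i.e., f(x⁺, y⁺) + f(x⁻, y⁻) ≤ f(x⁺, y⁻) + f(x⁻, y⁺) whenever x⁻ ≤ x⁺ and y⁻ ≤ y⁺. Suppose that for every x ∈ X the set of minimizers argmin_{y ∈ Y} f(x, y) is nonempty and possesses a greatest element, and define g(x) to be this greatest minimizer. Then g is monotone increasing: x⁻ ≤ x⁺ implies g(x⁻) ≤ g(x⁺). -/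
/-- Monotone selection from submodular minimization: if `f : X × Y → ℝ` is
submodular and for every `x` the argmin set over `y` has a greatest element
`g x`, then `g` is monotone increasing. -/
theorem greatest_argmin_monotone_of_submodular
    {X Y : Type*} [LinearOrder X] [LinearOrder Y]
    (f : X × Y → ℝ)
    (hsub : ∀ xm xp : X, ∀ ym yp : Y, xm ≤ xp → ym ≤ yp →
      f (xp, yp) + f (xm, ym) ≤ f (xp, ym) + f (xm, yp))
    (g : X → Y)
    (hg : ∀ x : X, IsGreatest {y : Y | ∀ y' : Y, f (x, y) ≤ f (x, y')} (g x)) :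
    Monotone g := by
  intro a b hab
  by_contra! hlt
  refine hlt.not_ge ((hg b).2 fun y => ?_)
  linarith [hsub a b (g b) (g a) hab hlt.le, (hg a).1 (g b), (hg b).1 y]
end

section
/- Let λ > 0 be a real number and E : ℕ → ℝ be any function. Define J(w, θ) = E(θ) + w/(λθ + 1) for w ∈ ℝ and θ ∈ ℕ. Suppose that for every w ∈ ℝ the set of minimizers argmin_{θ ∈ ℕ} J(w, θ) is nonempty and has a greatest element θ⋆(w). Then θ⋆ is monotone increasing: w ≤ w' implies θ⋆(w) ≤ θ⋆(w'). -/
/-- Monotonicity of the optimal threshold: with total cost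
`J(w, θ) = E(θ) + w / (λθ + 1)`, if for every penalty `w` the argmin set over
thresholds `θ` has a greatest element `θ⋆(w)`, then `θ⋆` is monotone. -/
theorem optimal_threshold_monotone (lam : ℝ) (hlam : 0 < lam)
    (E : ℕ → ℝ) (J : ℝ → ℕ → ℝ)
    (hJ : ∀ (w : ℝ) (θ : ℕ), J w θ = E θ + w / (lam * θ + 1))
    (θstar : ℝ → ℕ)
    (hstar : ∀ w : ℝ, IsGreatest {θ : ℕ | ∀ θ' : ℕ, J w θ ≤ J w θ'} (θstar w)) :
    Monotone θstar := by
  intro w w' hw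
  by_contra! hlt
  have hinv : (lam * θstar w + 1)⁻¹ ≤ (lam * θstar w' + 1)⁻¹ := by
    gcongr
  have hle := (hstar w).1 (θstar w')
  have hprod := mul_le_mul_of_nonneg_left hinv (sub_nonneg.2 hw)
  have hmin : J w' (θstar w) ≤ J w' (θstar w') := by
    simp only [hJ, div_eq_mul_inv] at hle ⊢
    linarith
  exact hlt.not_ge ((hstar w').2 fun θ => hmin.trans ((hstar w').1 θ))
end

section
/- Let λ ∈ (0, 1] be a real number and θ ∈ ℕ. Define π : ℕ → ℝ by π(τ) = λ/(λθ + 1) if τ ≤ θ, and π(τ) = (λ/(λθ + 1))·(1 − λ)^{τ − θ} if τ > θ. Then π satisfies the stationarity (invariance) equations of the Markov chain on ℕ induced by the threshold-θ policy: (i) π(0) = λ · Σ_{τ=θ}^{∞} π(τ); (ii) for every τ ∈ ℕ with τ < θ, π(τ + 1) = π(τ); and (iii) for every τ ∈ ℕ with τ ≥ θ, π(τ + 1) = (1 − λ)·π(τ). -/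
/-- The distribution `π` satisfies the stationarity (invariance) equations of
the Markov chain on `ℕ` induced by the threshold-`θ` policy. -/
theorem threshold_stationary_invariance (lam : ℝ) (hlam : 0 < lam) (hlam1 : lam ≤ 1)
    (θ : ℕ) (π : ℕ → ℝ)
    (hπ : ∀ τ : ℕ, π τ = if τ ≤ θ then lam / (lam * θ + 1)
      else lam / (lam * θ + 1) * (1 - lam) ^ (τ - θ)) :
    π 0 = lam * ∑' τ : ℕ, π (θ + τ) ∧
    (∀ τ : ℕ, τ < θ → π (τ + 1) = π τ) ∧
    (∀ τ : ℕ, θ ≤ τ → π (τ + 1) = (1 - lam) * π τ) := by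
  have tail (k : ℕ) : π (θ + k) = lam / (lam * θ + 1) * (1 - lam) ^ k := by
    rw [hπ]
    rcases Nat.eq_zero_or_pos k with rfl | hk
    · simp
    · rw [if_neg (by omega), Nat.add_sub_cancel_left]
  refine ⟨?_, fun τ hτ => ?_, fun τ hτ => ?_⟩
  · simp_rw [tail]
    rw [tsum_mul_left, tsum_geometric_of_lt_one (by linarith) (by linarith), hπ,
      if_pos (Nat.zero_le θ), sub_sub_cancel]
    field_simp
  · rw [hπ, hπ, if_pos (Nat.succ_le_of_lt hτ), if_pos hτ.le]
  · obtain ⟨k, rfl⟩ := Nat.exists_eq_add_of_le hτ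
    rw [add_assoc, tail, tail, pow_succ]
    ring
end

section
/- Let A, Q, P be n × n real matrices, let λ ∈ (0, 1), and define h(X) = A X Aᵀ + Q. Suppose the two matrix series S_P := Σ_{t=0}^{∞} (1 − λ)^t A^t P (Aᵀ)^t and S_Q := Σ_{t=0}^{∞} (1 − λ)^t A^t Q (Aᵀ)^t are summable. Then the real series Σ_{t=0}^{∞} λ (1 − λ)^t · Tr(h^t(P)) is summable and its sum equals λ · Tr(S_P) + (1 − λ) · Tr(S_Q). -/
open Matrix in
/-- Closed form of the iterates of the Lyapunov operator `X ↦ A X Aᵀ + Q`. -/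
theorem iterate_lyapunov {ι R : Type*} [Fintype ι] [DecidableEq ι] [CommSemiring R]
    (A Q P : Matrix ι ι R) (t : ℕ) :
    (fun Y : Matrix ι ι R => A * Y * Aᵀ + Q)^[t] P =
      A ^ t * P * Aᵀ ^ t + ∑ s ∈ Finset.range t, A ^ s * Q * Aᵀ ^ s := by
  induction t with
  | zero => simp
  | succ t ih =>
    rw [Function.iterate_succ_apply', ih, Finset.sum_range_succ']
    simp only [mul_add, add_mul, Finset.mul_sum, Finset.sum_mul, pow_succ' A, pow_succ Aᵀ,
      Matrix.mul_assoc, pow_zero, Matrix.one_mul, Matrix.mul_one, add_assoc]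

/-- Discounted sums of the partial sums of a sequence. -/
theorem hasSum_pow_mul_sum_range {q S : ℝ} (hq0 : 0 ≤ q) (hq1 : q < 1) {b : ℕ → ℝ}
    (hb : HasSum (fun t => q ^ t * b t) S) :
    HasSum (fun t => q ^ t * ∑ s ∈ Finset.range t, b s) (q * (S * (1 - q)⁻¹)) := by
  have hg := summable_geometric_of_lt_one hq0 hq1
  have hbn := hb.summable.norm
  have hs := (summable_norm_sum_mul_range_of_summable_norm hbn hg.norm).of_norm.hasSum
  rw [← tsum_mul_tsum_eq_tsum_sum_range_of_summable_norm hbn hg.norm, hb.tsum_eq,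
    tsum_geometric_of_lt_one hq0 hq1] at hs
  rw [← hasSum_nat_add_iff' 1]
  simp only [Finset.range_one, Finset.sum_singleton, Finset.range_zero, Finset.sum_empty,
    mul_zero, sub_zero]
  refine (hs.mul_left q).congr_fun fun t => ?_
  rw [pow_succ', mul_assoc, Finset.mul_sum]
  congr 1
  refine Finset.sum_congr rfl fun s hst => ?_
  rw [← Nat.add_sub_of_le (Nat.lt_succ_iff.mp (Finset.mem_range.mp hst)), pow_add]
  simp only [Nat.add_sub_cancel_left]
  ring


open Matrix in
/-- The time-averaged estimation error under the threshold-`0` policy: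
`Σ_t λ(1-λ)^t Tr(h^t(P)) = λ Tr(S_P) + (1-λ) Tr(S_Q)`. -/
theorem averaged_error_threshold_zero {n : ℕ}
    (A Q P : Matrix (Fin n) (Fin n) ℝ) (lam : ℝ) (hlam : 0 < lam) (hlam1 : lam < 1)
    (hP : Summable (fun t : ℕ => (1 - lam) ^ t • (A ^ t * P * Aᵀ ^ t)))
    (hQ : Summable (fun t : ℕ => (1 - lam) ^ t • (A ^ t * Q * Aᵀ ^ t))) :
    Summable (fun t : ℕ =>
      lam * (1 - lam) ^ t *
        ((fun Y : Matrix (Fin n) (Fin n) ℝ => A * Y * Aᵀ + Q)^[t] P).trace) ∧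
    ∑' t : ℕ, lam * (1 - lam) ^ t *
        ((fun Y : Matrix (Fin n) (Fin n) ℝ => A * Y * Aᵀ + Q)^[t] P).trace =
      lam * (∑' t : ℕ, (1 - lam) ^ t • (A ^ t * P * Aᵀ ^ t)).trace +
        (1 - lam) * (∑' t : ℕ, (1 - lam) ^ t • (A ^ t * Q * Aᵀ ^ t)).trace := by
  have trace_hasSum (M : Matrix (Fin n) (Fin n) ℝ)
      (hM : Summable (fun t : ℕ => (1 - lam) ^ t • (A ^ t * M * Aᵀ ^ t))) :
      HasSum (fun t : ℕ => (1 - lam) ^ t * (A ^ t * M * Aᵀ ^ t).trace)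
        (∑' t : ℕ, (1 - lam) ^ t • (A ^ t * M * Aᵀ ^ t)).trace := by
    simpa [Function.comp_def] using
      hM.hasSum.map (Matrix.traceAddMonoidHom (Fin n) ℝ) continuous_id.matrix_trace
  have key := ((trace_hasSum P hP).add (hasSum_pow_mul_sum_range (sub_nonneg.mpr hlam1.le)
    (sub_lt_self 1 hlam) (trace_hasSum Q hQ))).mul_left lam
  have h : HasSum (fun t : ℕ => lam * (1 - lam) ^ t *
      ((fun Y : Matrix (Fin n) (Fin n) ℝ => A * Y * Aᵀ + Q)^[t] P).trace)
      (lam * (∑' t : ℕ, (1 - lam) ^ t • (A ^ t * P * Aᵀ ^ t)).trace +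
        (1 - lam) * (∑' t : ℕ, (1 - lam) ^ t • (A ^ t * Q * Aᵀ ^ t)).trace) := by
    have hval (x y : ℝ) : lam * x + (1 - lam) * y =
        lam * (x + (1 - lam) * (y * (1 - (1 - lam))⁻¹)) := by
      rw [sub_sub_cancel]
      field_simp
    rw [hval]
    refine key.congr_fun fun t => ?_
    rw [iterate_lyapunov, Matrix.trace_add, Matrix.trace_sum]
    ring
  exact ⟨h.summable, h.tsum_eq⟩
end

section
/- Let λ ∈ (0, 1) be a real number, t ∈ ℕ, and let c_c, w, ρ, J_e be real numbers, c_e : ℕ → ℝ, and V : ℕ → ℝ. Suppose: (i) for every t' ∈ ℕ with t' ≤ t, V(t') + ρ = c_e(t') + V(t' + 1); (ii) c_c + w = λ·(V(t + 1) − V(0)); and (iii) ρ = J_e + (c_c + w)/(λt + 1). Then w = (λ(λt + 1)/(1 − λ)) · [ (t + 1)·J_e − Σ_{t'=0}^{t} c_e(t') ] − c_c. -/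
/-- Closed-form expression of the Whittle index from the Poisson equation,
the indifference condition, and the cost decomposition. -/
theorem whittle_index_closed_form (lam : ℝ) (hlam : 0 < lam) (hlam1 : lam < 1)
    (t : ℕ) (cc w ρ Je : ℝ) (ce : ℕ → ℝ) (V : ℕ → ℝ)
    (hPoisson : ∀ t' : ℕ, t' ≤ t → V t' + ρ = ce t' + V (t' + 1))
    (hIndiff : cc + w = lam * (V (t + 1) - V 0))
    (hCost : ρ = Je + (cc + w) / (lam * t + 1)) :
    w = lam * (lam * t + 1) / (1 - lam) *
          ((t + 1) * Je - ∑ t' ∈ Finset.range (t + 1), ce t') - cc := by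
  have hsum : V (t + 1) - V 0 = (t + 1) * ρ - ∑ t' ∈ Finset.range (t + 1), ce t' := by
    rw [← Finset.sum_range_sub V (t + 1),
      Finset.sum_congr rfl fun i hi =>
        show V (i + 1) - V i = ρ - ce i by
          linarith [hPoisson i (Nat.lt_succ_iff.mp (Finset.mem_range.mp hi))]]
    simp [Finset.sum_sub_distrib]
  have hden : lam * t + 1 ≠ 0 := by positivity
  have hlam_sub : 1 - lam ≠ 0 := by linarith
  rw [hsum, hCost] at hIndiff
  field_simp at hIndiff ⊢
  linear_combination hIndiff
end
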